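/- Suppose the DFP initialization satisfies σ_0 ≤ ε and ‖B̂_0 − I‖_F ≤ δ, where ε, δ > 0 are such that for some r ∈ (0, 1) both [4(2δ + 1)/(1 − ε)² + (3 + ε)/(1 − ε)]·ε/(1 − r) ≤ δ and ε + 2δ ≤ r/(1 + r). Then for every k ≥ 1, Σ_{t=0}^{k−1} ‖(B̂_t − I)ŝ_t‖/‖ŝ_t‖ ≤ 2√2·δ·√k. -/

import Mathlib

noncomputable section

open Matrix Finset

abbrev E (d : ℕ) := EuclideanSpace ℝ (Fin d)
abbrev Mat (d : ℕ) := Matrix (Fin d) (Fin d) ℝ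

/-- Spectral (operator 2-) norm of a real matrix. -/
def spec {d : ℕ} (A : Mat d) : ℝ := ‖Matrix.toEuclideanCLM (𝕜 := ℝ) A‖

/-- Frobenius norm of a real matrix. -/
def frob {d : ℕ} (A : Mat d) : ℝ := Real.sqrt (∑ i, ∑ j, (A i j) ^ 2)

/-- A matrix acting on a Euclidean vector. -/
def mApp {d : ℕ} (A : Mat d) (v : E d) : E d := Matrix.toEuclideanCLM (𝕜 := ℝ) A v

/-- Outer product `u vᵀ`. -/
def outer {d : ℕ} (u v : E d) : Mat d := Matrix.of fun i j => u i * v j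

/-- Euclidean dot product. -/
def dot {d : ℕ} (u v : E d) : ℝ := ∑ i, u i * v i

/-- `σ(x) = (M/μ^{3/2})·‖H_*^{1/2}(x − x_*)‖`. -/
def sig {d : ℕ} (M μ : ℝ) (sqH : Mat d) (xs x : E d) : ℝ :=
  M / μ ^ ((3:ℝ)/2) * ‖mApp sqH (x - xs)‖

/-- The DFP update of the Hessian approximation. -/
def dfpUpdate {d : ℕ} (B : Mat d) (s y : E d) : Mat d :=
  (1 - (dot y s)⁻¹ • outer y s) * B * (1 - (dot s y)⁻¹ • outer s y)
    + (dot y s)⁻¹ • outer y y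

lemma mApp_apply {d : ℕ} (A : Mat d) (v : E d) (i : Fin d) :
    mApp A v i = ∑ j, A i j * v j := by
  simp [mApp, Matrix.mulVec, dotProduct]

lemma mApp_mul {d : ℕ} (A B : Mat d) (v : E d) : mApp (A * B) v = mApp A (mApp B v) := by
  simp [mApp]

lemma mApp_one {d : ℕ} (v : E d) : mApp (1 : Mat d) v = v := by
  simp [mApp]

lemma mApp_vec_sub {d : ℕ} (A : Mat d) (v w : E d) :
    mApp A (v - w) = mApp A v - mApp A w := by
  simp [mApp]

lemma mApp_mat_sub {d : ℕ} (A B : Mat d) (v : E d) :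
    mApp (A - B) v = mApp A v - mApp B v := by
  simp [mApp]

lemma norm_mApp_le {d : ℕ} (A : Mat d) (v : E d) : ‖mApp A v‖ ≤ spec A * ‖v‖ :=
  ContinuousLinearMap.le_opNorm _ _

lemma spec_nonneg {d : ℕ} (A : Mat d) : 0 ≤ spec A := norm_nonneg _

lemma spec_le {d : ℕ} (A : Mat d) {c : ℝ} (hc : 0 ≤ c) (h : ∀ v, ‖mApp A v‖ ≤ c * ‖v‖) :
    spec A ≤ c :=
  ContinuousLinearMap.opNorm_le_bound _ hc h

lemma spec_add_le {d : ℕ} (A B : Mat d) : spec (A + B) ≤ spec A + spec B := by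
  simpa [spec] using norm_add_le (Matrix.toEuclideanCLM (𝕜 := ℝ) A)
    (Matrix.toEuclideanCLM (𝕜 := ℝ) B)

lemma spec_mul_le {d : ℕ} (A B : Mat d) : spec (A * B) ≤ spec A * spec B := by
  simpa [spec] using norm_mul_le (Matrix.toEuclideanCLM (𝕜 := ℝ) A)
    (Matrix.toEuclideanCLM (𝕜 := ℝ) B)

lemma spec_one_le {d : ℕ} : spec (1 : Mat d) ≤ 1 :=
  spec_le _ zero_le_one fun v => by simp [mApp_one]

lemma spec_transpose {d : ℕ} (A : Mat d) : spec Aᵀ = spec A := by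
  have h : Aᵀ = star A := by
    rw [Matrix.star_eq_conjTranspose, Matrix.conjTranspose_eq_transpose_of_trivial]
  rw [spec, h, map_star]
  exact LinearIsometryEquiv.norm_map ContinuousLinearMap.adjoint _

lemma dot_eq_inner {d : ℕ} (u v : E d) : dot u v = inner ℝ u v := by
  simp [dot, PiLp.inner_apply, mul_comm]

lemma dot_comm {d : ℕ} (u v : E d) : dot u v = dot v u := by
  simp [dot, mul_comm]

lemma dot_self {d : ℕ} (u : E d) : dot u u = ‖u‖ ^ 2 := by
  rw [dot_eq_inner, real_inner_self_eq_norm_sq]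

lemma dot_mApp {d : ℕ} (A : Mat d) (u v : E d) : dot u (mApp A v) = dot (mApp Aᵀ u) v := by
  simp only [dot, mApp_apply, Matrix.transpose_apply, Finset.mul_sum, Finset.sum_mul]
  rw [Finset.sum_comm]
  exact Finset.sum_congr rfl fun _ _ => Finset.sum_congr rfl fun _ _ => by ring

lemma mul_outer {d : ℕ} (A : Mat d) (u v : E d) : A * outer u v = outer (mApp A u) v := by
  ext i j
  simp [outer, Matrix.mul_apply, mApp_apply, Finset.sum_mul, mul_assoc]

lemma outer_mul {d : ℕ} (A : Mat d) (u v : E d) : outer u v * A = outer u (mApp Aᵀ v) := by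
  ext i j
  simp only [outer, Matrix.mul_apply, mApp_apply, Matrix.of_apply, Matrix.transpose_apply,
    Finset.mul_sum]
  exact Finset.sum_congr rfl fun _ _ => by ring

lemma mApp_outer {d : ℕ} (u v w : E d) : mApp (outer u v) w = dot v w • u := by
  ext i
  simp only [mApp_apply, outer, Matrix.of_apply, dot, PiLp.smul_apply, smul_eq_mul, Finset.sum_mul]
  exact Finset.sum_congr rfl fun _ _ => by ring

lemma transpose_outer {d : ℕ} (u v : E d) : (outer u v)ᵀ = outer v u := by
  ext i j
  simp [outer, mul_comm]

lemma frob_nonneg {d : ℕ} (A : Mat d) : 0 ≤ frob A := Real.sqrt_nonneg _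

lemma frob_sq {d : ℕ} (A : Mat d) : frob A ^ 2 = ∑ i, ∑ j, (A i j) ^ 2 :=
  Real.sq_sqrt (by positivity)

lemma frob_add_le {d : ℕ} (A B : Mat d) : frob (A + B) ≤ frob A + frob B := by
  have key : ∀ C : Mat d, frob C = ‖WithLp.toLp 2 (fun p : Fin d × Fin d => C p.1 p.2)‖ := by
    intro C
    simp [frob, EuclideanSpace.norm_eq, Fintype.sum_prod_type]
  rw [key, key, key]
  exact norm_add_le (WithLp.toLp 2 (fun p : Fin d × Fin d => A p.1 p.2))
    (WithLp.toLp 2 (fun p : Fin d × Fin d => B p.1 p.2))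

lemma frob_transpose {d : ℕ} (A : Mat d) : frob Aᵀ = frob A := by
  simp only [frob, Matrix.transpose_apply]
  rw [Finset.sum_comm]

lemma frob_outer {d : ℕ} (u v : E d) : frob (outer u v) = ‖u‖ * ‖v‖ := by
  rw [← sq_eq_sq₀ (frob_nonneg _) (by positivity), frob_sq, mul_pow, ← dot_self, ← dot_self]
  simp only [outer, Matrix.of_apply, dot, Finset.sum_mul_sum]
  exact Finset.sum_congr rfl fun _ _ => Finset.sum_congr rfl fun _ _ => by ring

lemma spec_le_frob {d : ℕ} (A : Mat d) : spec A ≤ frob A := by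
  refine spec_le _ (frob_nonneg _) fun v => ?_
  rw [← sq_le_sq₀ (norm_nonneg _) (mul_nonneg (frob_nonneg _) (norm_nonneg _)), mul_pow, frob_sq,
    ← dot_self, ← dot_self, Finset.sum_mul]
  simp only [dot, ← sq, mApp_apply]
  exact Finset.sum_le_sum fun i _ => Finset.sum_mul_sq_le_sq_mul_sq _ _ _

lemma frob_mul_le_left {d : ℕ} (A B : Mat d) : frob (A * B) ≤ spec A * frob B := by
  rw [← sq_le_sq₀ (frob_nonneg _) (mul_nonneg (spec_nonneg _) (frob_nonneg _)), mul_pow,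
    frob_sq, frob_sq, Finset.sum_comm, Finset.sum_comm (f := fun i j => B i j ^ 2),
    Finset.mul_sum]
  refine Finset.sum_le_sum fun j _ => ?_
  have h := pow_le_pow_left₀ (norm_nonneg _) (norm_mApp_le A (WithLp.toLp 2 fun i => B i j)) 2
  rw [mul_pow, ← dot_self, ← dot_self] at h
  simpa [dot, ← sq, mApp_apply, Matrix.mul_apply] using h

lemma frob_mul_le_right {d : ℕ} (A B : Mat d) : frob (A * B) ≤ frob A * spec B := by
  rw [← frob_transpose, Matrix.transpose_mul, mul_comm, ← frob_transpose A, ← spec_transpose]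
  exact frob_mul_le_left _ _

lemma frob_mul_proj_sq {d : ℕ} (A : Mat d) {s : E d} (hs : s ≠ 0) :
    frob (A * (1 - (dot s s)⁻¹ • outer s s)) ^ 2 =
      frob A ^ 2 - (dot s s)⁻¹ * ‖mApp A s‖ ^ 2 := by
  have hne : dot s s ≠ 0 := by rw [dot_self]; positivity
  rw [mul_sub, mul_one, mul_smul_comm, mul_outer, frob_sq, frob_sq, ← dot_self (mApp A s),
    show dot (mApp A s) (mApp A s) = ∑ i, mApp A s i * mApp A s i from rfl, Finset.mul_sum,
    ← Finset.sum_sub_distrib]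
  refine Finset.sum_congr rfl fun i _ => ?_
  have h1 : ∑ j, A i j * s j = mApp A s i := (mApp_apply A s i).symm
  have h2 : ∑ j, s j * s j = dot s s := rfl
  generalize mApp A s = w at *
  have : ∀ j, (A - (dot s s)⁻¹ • outer w s) i j ^ 2 =
      A i j ^ 2 - 2 * (dot s s)⁻¹ * w i * (A i j * s j)
        + ((dot s s)⁻¹ * w i) ^ 2 * (s j * s j) := by
    intro j
    simp only [outer, Matrix.sub_apply, Matrix.smul_apply, Matrix.of_apply, smul_eq_mul]
    ring
  simp only [this, Finset.sum_add_distrib, Finset.sum_sub_distrib, ← Finset.mul_sum, h1, h2]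
  field_simp
  ring

lemma spec_proj_le_one {d : ℕ} {s : E d} (hs : s ≠ 0) :
    spec (1 - (dot s s)⁻¹ • outer s s) ≤ 1 := by
  refine spec_le _ zero_le_one fun v => ?_
  have hne : dot s s ≠ 0 := by rw [dot_self]; positivity
  have hv : mApp (1 - (dot s s)⁻¹ • outer s s) v = v - ((dot s s)⁻¹ * dot s v) • s := by
    have h : mApp ((dot s s)⁻¹ • outer s s) v = (dot s s)⁻¹ • mApp (outer s s) v := by simp [mApp]
    rw [mApp_mat_sub, mApp_one, h, mApp_outer, smul_smul]
  rw [one_mul, ← sq_le_sq₀ (norm_nonneg _) (norm_nonneg _), hv, norm_sub_sq_real, norm_smul,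
    inner_smul_right, ← dot_eq_inner, dot_comm v s, mul_pow, ← dot_self s, Real.norm_eq_abs, sq_abs]
  have : ((dot s s)⁻¹ * dot s v) ^ 2 * dot s s = (dot s s)⁻¹ * dot s v ^ 2 := by
    field_simp
  rw [this]
  have : 0 ≤ (dot s s)⁻¹ * dot s v ^ 2 := by rw [dot_self]; positivity
  nlinarith

lemma outer_sub_left {d : ℕ} (u v w : E d) : outer (u - v) w = outer u w - outer v w := by
  ext i j
  simp [outer, sub_mul]

lemma outer_sub_right {d : ℕ} (u v w : E d) : outer u (v - w) = outer u v - outer u w := by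
  ext i j
  simp [outer, mul_sub]

lemma outer_smul_left {d : ℕ} (c : ℝ) (u v : E d) : outer (c • u) v = c • outer u v := by
  ext i j
  simp [outer, mul_assoc]

lemma le_dot_of_norm_sub_le {d : ℕ} {s y : E d} {τ : ℝ} (hy : ‖y - s‖ ≤ τ * ‖s‖) :
    (1 - τ) * ‖s‖ ^ 2 ≤ dot y s := by
  have h1 : dot y s = ‖s‖ ^ 2 + inner ℝ (y - s) s := by
    rw [dot_eq_inner, inner_sub_left, real_inner_self_eq_norm_sq]; ring
  have h2 : -(‖y - s‖ * ‖s‖) ≤ inner ℝ (y - s) s :=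
    neg_le_of_abs_le (abs_real_inner_le_norm _ _)
  nlinarith [mul_le_mul_of_nonneg_right hy (norm_nonneg s)]

lemma norm_scaled_sub_mul_norm_le {d : ℕ} {s y : E d} {τ : ℝ} (hs : s ≠ 0) (hτ0 : 0 ≤ τ)
    (hτ : τ < 1) (hy : ‖y - s‖ ≤ τ * ‖s‖) :
    ‖(dot s s)⁻¹ • s - (dot y s)⁻¹ • y‖ * ‖s‖ ≤ 2 * τ / (1 - τ) := by
  have hpos : 0 < ‖s‖ := norm_pos_iff.2 hs
  have h1τ : 0 < 1 - τ := by linarith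
  have hlow := le_dot_of_norm_sub_le hy
  have hdot : 0 < dot y s := lt_of_lt_of_le (by positivity) hlow
  have hnum : ‖dot y s • s - dot s s • y‖ ≤ 2 * τ * ‖s‖ ^ 3 := by
    have heq : dot y s • s - dot s s • y = (inner ℝ (y - s) s) • s - (‖s‖ ^ 2) • (y - s) := by
      rw [dot_self, inner_sub_left, real_inner_self_eq_norm_sq, dot_eq_inner]
      module
    have h2 : |inner ℝ (y - s) s| ≤ ‖y - s‖ * ‖s‖ := abs_real_inner_le_norm _ _
    calc ‖dot y s • s - dot s s • y‖
        ≤ |inner ℝ (y - s) s| * ‖s‖ + ‖s‖ ^ 2 * ‖y - s‖ := by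
          rw [heq]
          refine (norm_sub_le _ _).trans_eq ?_
          rw [norm_smul, norm_smul, Real.norm_eq_abs, Real.norm_of_nonneg (by positivity)]
      _ ≤ (τ * ‖s‖ * ‖s‖) * ‖s‖ + ‖s‖ ^ 2 * (τ * ‖s‖) := by
          gcongr
          exact h2.trans (by gcongr)
      _ = 2 * τ * ‖s‖ ^ 3 := by ring
  have heq : (dot s s)⁻¹ • s - (dot y s)⁻¹ • y =
      ((dot s s)⁻¹ * (dot y s)⁻¹) • (dot y s • s - dot s s • y) := by
    have : dot s s ≠ 0 := by rw [dot_self]; positivity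
    rw [smul_sub, smul_smul, smul_smul]
    congr 2 <;> field_simp
  rw [heq, norm_smul, Real.norm_of_nonneg (by rw [dot_self]; positivity)]
  calc (dot s s)⁻¹ * (dot y s)⁻¹ * ‖dot y s • s - dot s s • y‖ * ‖s‖
      ≤ (dot s s)⁻¹ * (dot y s)⁻¹ * (2 * τ * ‖s‖ ^ 3) * ‖s‖ := by
        have : 0 ≤ (dot s s)⁻¹ := by rw [dot_self]; positivity
        gcongr
    _ = 2 * τ * ‖s‖ ^ 2 / dot y s := by rw [dot_self]; field_simp
    _ ≤ 2 * τ * ‖s‖ ^ 2 / ((1 - τ) * ‖s‖ ^ 2) := by gcongr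
    _ = 2 * τ / (1 - τ) := by field_simp

lemma frob_proj_mul_proj_le {d : ℕ} (A : Mat d) {s : E d} {D : ℝ} (hs : s ≠ 0) (hD : 0 < D)
    (hA : frob A ≤ D) :
    frob ((1 - (dot s s)⁻¹ • outer s s) * (A * (1 - (dot s s)⁻¹ • outer s s))) ≤
      frob A - (‖mApp A s‖ / ‖s‖) ^ 2 / (2 * D) := by
  have hpos : 0 < ‖s‖ := norm_pos_iff.2 hs
  have h1 := (frob_mul_le_left (1 - (dot s s)⁻¹ • outer s s)
    (A * (1 - (dot s s)⁻¹ • outer s s))).trans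
      (mul_le_of_le_one_left (frob_nonneg _) (spec_proj_le_one hs))
  refine h1.trans ?_
  have h2 := frob_mul_proj_sq A hs
  have h3 : (dot s s)⁻¹ * ‖mApp A s‖ ^ 2 = (‖mApp A s‖ / ‖s‖) ^ 2 := by
    rw [dot_self, div_pow]; ring
  rw [h3] at h2
  have h4 : ‖mApp A s‖ / ‖s‖ ≤ frob A := by
    rw [div_le_iff₀ hpos]
    exact (norm_mApp_le A s).trans (by gcongr; exact spec_le_frob A)
  have h4' : 0 ≤ ‖mApp A s‖ / ‖s‖ := by positivity
  generalize ‖mApp A s‖ / ‖s‖ = θ at *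
  have hF := frob_nonneg A
  have h5 : θ ^ 2 / (2 * D) * (2 * D) = θ ^ 2 := by field_simp
  have h6 : 0 ≤ θ ^ 2 / (2 * D) := by positivity
  generalize θ ^ 2 / (2 * D) = q at *
  have hq : q ≤ frob A := by
    rcases hF.eq_or_lt with h0 | h0
    · have : θ = 0 := by linarith
      subst this
      nlinarith
    · nlinarith
  refine (sq_le_sq₀ (frob_nonneg _) (by linarith)).1 ?_
  nlinarith

lemma dfpUpdate_sub_one {d : ℕ} (B : Mat d) {s y : E d} (hs : s ≠ 0) :
    let P : Mat d := 1 - (dot s s)⁻¹ • outer s s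
    let Q : Mat d := 1 - (dot y s)⁻¹ • outer y s
    let w := (dot s s)⁻¹ • s - (dot y s)⁻¹ • y
    dfpUpdate B s y - 1 = P * ((B - 1) * P) + outer w s * (B * Qᵀ) + P * (B * outer s w)
      - outer w s + (dot y s)⁻¹ • outer y (y - s) := by
  intro P Q w
  have hne : dot s s ≠ 0 := by rw [dot_self]; positivity
  have hPP : P * P = P := by
    have : outer s s * outer s s = dot s s • outer s s := by
      rw [mul_outer, mApp_outer, outer_smul_left]
    simp only [P, sub_mul, mul_sub, one_mul, mul_one, smul_mul_assoc, mul_smul_comm, this,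
      smul_smul]
    rw [inv_mul_cancel₀ hne, one_smul, sub_self, smul_zero, sub_zero]
  have hw : outer w s = Q - P := by
    simp only [w, P, Q, outer_sub_left, outer_smul_left]; abel
  have hP : Pᵀ = P := by simp [P, transpose_outer]
  have hw' : outer s w = Qᵀ - P := by
    rw [← transpose_outer, hw, Matrix.transpose_sub, hP]
  have hy : (dot y s)⁻¹ • outer y (y - s) = (dot y s)⁻¹ • outer y y - 1 + Q := by
    rw [outer_sub_right, smul_sub]; simp only [Q]; abel
  have hQ : Qᵀ = 1 - (dot s y)⁻¹ • outer s y := by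
    simp [Q, transpose_outer, dot_comm s y]
  rw [hy, hw, hw', dfpUpdate, ← hQ]
  change Q * B * Qᵀ + _ - 1 = _
  have : P * ((B - 1) * P) = P * (B * P) - P := by
    rw [sub_mul B 1 P, mul_sub P, one_mul, hPP]
  rw [this]
  noncomm_ring

lemma frob_dfpUpdate_sub_one_le {d : ℕ} (B : Mat d) {s y : E d} {τ D : ℝ} (hs : s ≠ 0)
    (hτ0 : 0 ≤ τ) (hτ : τ < 1) (hD : 0 < D) (hB : frob (B - 1) ≤ D) (hy : ‖y - s‖ ≤ τ * ‖s‖) :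
    frob (dfpUpdate B s y - 1) ≤ frob (B - 1) - (‖mApp (B - 1) s‖ / ‖s‖) ^ 2 / (2 * D)
      + (4 * (D + 1) / (1 - τ) ^ 2 + (3 + τ) / (1 - τ)) * τ := by
  have h1τ : 0 < 1 - τ := by linarith
  have hpos : 0 < ‖s‖ := norm_pos_iff.2 hs
  have hlow := le_dot_of_norm_sub_le hy
  have hdot : 0 < dot y s := lt_of_lt_of_le (by positivity) hlow
  have key := dfpUpdate_sub_one B (y := y) hs
  have hP := spec_proj_le_one hs
  have hPAP := frob_proj_mul_proj_le (B - 1) hs hD hB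
  have hw := norm_scaled_sub_mul_norm_le hs hτ0 hτ hy
  dsimp only at key
  have hQP : (1 - (dot y s)⁻¹ • outer y s : Mat d) = (1 - (dot s s)⁻¹ • outer s s)
      + outer ((dot s s)⁻¹ • s - (dot y s)⁻¹ • y) s := by
    simp only [outer_sub_left, outer_smul_left]; abel
  generalize hwdef : (dot s s)⁻¹ • s - (dot y s)⁻¹ • y = w at *
  generalize (1 - (dot s s)⁻¹ • outer s s : Mat d) = P at *
  generalize (1 - (dot y s)⁻¹ • outer y s : Mat d) = Q at *
  have hfw : frob (outer w s) ≤ 2 * τ / (1 - τ) := by rw [frob_outer]; exact hw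
  have hfw' : frob (outer s w) ≤ 2 * τ / (1 - τ) := by
    rw [frob_outer, mul_comm]; exact hw
  have hQ : spec Qᵀ ≤ (1 + τ) / (1 - τ) := by
    rw [spec_transpose, hQP]
    calc spec (P + outer w s) ≤ 1 + 2 * τ / (1 - τ) :=
          (spec_add_le _ _).trans (add_le_add hP ((spec_le_frob _).trans hfw))
      _ = (1 + τ) / (1 - τ) := by field_simp; ring
  have hBs : spec B ≤ D + 1 := by
    calc spec B = spec ((B - 1) + 1) := by rw [sub_add_cancel]
      _ ≤ D + 1 := (spec_add_le _ _).trans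
        (add_le_add ((spec_le_frob _).trans hB) spec_one_le)
  have h2τ : 0 ≤ 2 * τ / (1 - τ) := by positivity
  have hT2 : frob (outer w s * (B * Qᵀ)) ≤ 2 * τ / (1 - τ) * ((D + 1) * ((1 + τ) / (1 - τ))) := by
    refine (frob_mul_le_right _ _).trans ?_
    gcongr
    · exact spec_nonneg _
    · refine (spec_mul_le _ _).trans ?_
      gcongr
      exact spec_nonneg _
  have hT3 : frob (P * (B * outer s w)) ≤ (D + 1) * (2 * τ / (1 - τ)) := by
    refine ((frob_mul_le_left _ _).trans
      (mul_le_of_le_one_left (frob_nonneg _) hP)).trans ((frob_mul_le_left _ _).trans ?_)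
    gcongr
    exact frob_nonneg _
  have hT5 : frob ((dot y s)⁻¹ • outer y (y - s)) ≤ (1 + τ) * τ / (1 - τ) := by
    rw [← outer_smul_left, frob_outer, norm_smul, Real.norm_of_nonneg (by positivity)]
    have hyn : ‖y‖ ≤ (1 + τ) * ‖s‖ := by
      calc ‖y‖ = ‖s + (y - s)‖ := by rw [add_sub_cancel]
        _ ≤ ‖s‖ + τ * ‖s‖ := (norm_add_le _ _).trans (by gcongr)
        _ = (1 + τ) * ‖s‖ := by ring
    calc (dot y s)⁻¹ * ‖y‖ * ‖y - s‖
        ≤ ((1 - τ) * ‖s‖ ^ 2)⁻¹ * ((1 + τ) * ‖s‖) * (τ * ‖s‖) := by gcongr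
      _ = (1 + τ) * τ / (1 - τ) := by field_simp
  have hneg : frob (-outer w s) = frob (outer w s) := by simp [frob]
  rw [key, sub_eq_add_neg _ (outer w s)]
  have hsum := (frob_add_le (P * ((B - 1) * P) + outer w s * (B * Qᵀ) + P * (B * outer s w)
      + -outer w s) ((dot y s)⁻¹ • outer y (y - s)))
  have hsum2 := frob_add_le (P * ((B - 1) * P) + outer w s * (B * Qᵀ) + P * (B * outer s w))
    (-outer w s)
  have hsum3 := frob_add_le (P * ((B - 1) * P) + outer w s * (B * Qᵀ)) (P * (B * outer s w))
  have hsum4 := frob_add_le (P * ((B - 1) * P)) (outer w s * (B * Qᵀ))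
  have heq : 2 * τ / (1 - τ) * ((D + 1) * ((1 + τ) / (1 - τ))) + (D + 1) * (2 * τ / (1 - τ))
      + 2 * τ / (1 - τ) + (1 + τ) * τ / (1 - τ)
      = (4 * (D + 1) / (1 - τ) ^ 2 + (3 + τ) / (1 - τ)) * τ := by
    field_simp
    ring
  linarith

lemma sqrt_mul_norm_le_norm_mApp {d : ℕ} {S H : Mat d} {μ : ℝ} (hμ : 0 < μ) (hST : Sᵀ = S)
    (hSS : S * S = H) (hH : ∀ v, μ * ‖v‖ ^ 2 ≤ dot v (mApp H v)) (v : E d) :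
    Real.sqrt μ * ‖v‖ ≤ ‖mApp S v‖ := by
  rw [← sq_le_sq₀ (by positivity) (norm_nonneg _), mul_pow, Real.sq_sqrt hμ.le]
  refine (hH v).trans_eq ?_
  rw [← hSS, mApp_mul, dot_mApp, hST, dot_self]

lemma mApp_mApp_inv {d : ℕ} {S : Mat d} (hS : IsUnit S.det) (v : E d) :
    mApp S (mApp S⁻¹ v) = v := by
  rw [← mApp_mul, Matrix.mul_nonsing_inv _ hS, mApp_one]

lemma mApp_inv_mApp {d : ℕ} {S : Mat d} (hS : IsUnit S.det) (v : E d) :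
    mApp S⁻¹ (mApp S v) = v := by
  rw [← mApp_mul, Matrix.nonsing_inv_mul _ hS, mApp_one]

lemma inv_mul_dfpUpdate_mul_inv {d : ℕ} {S : Mat d} (hS : IsUnit S.det) (hST : Sᵀ = S)
    (B : Mat d) (s y : E d) :
    S⁻¹ * dfpUpdate B s y * S⁻¹ = dfpUpdate (S⁻¹ * B * S⁻¹) (mApp S s) (mApp S⁻¹ y) := by
  have hRT : S⁻¹ᵀ = S⁻¹ := by rw [Matrix.transpose_nonsing_inv, hST]
  have hdot : dot (mApp S⁻¹ y) (mApp S s) = dot y s := by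
    rw [dot_mApp, hST, mApp_mApp_inv hS]
  have hdot' : dot (mApp S s) (mApp S⁻¹ y) = dot s y := by
    rw [dot_comm, hdot, dot_comm]
  have h1 : (1 - (dot y s)⁻¹ • outer (mApp S⁻¹ y) (mApp S s)) * S⁻¹
      = S⁻¹ * (1 - (dot y s)⁻¹ • outer y s) := by
    rw [sub_mul, mul_sub, one_mul, mul_one, smul_mul_assoc, mul_smul_comm, outer_mul, mul_outer,
      hRT, mApp_inv_mApp hS]
  have h2 : S⁻¹ * (1 - (dot s y)⁻¹ • outer (mApp S s) (mApp S⁻¹ y))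
      = (1 - (dot s y)⁻¹ • outer s y) * S⁻¹ := by
    rw [sub_mul, mul_sub, one_mul, mul_one, smul_mul_assoc, mul_smul_comm, outer_mul, mul_outer,
      hRT, mApp_inv_mApp hS]
  have h3 : outer (mApp S⁻¹ y) (mApp S⁻¹ y) = S⁻¹ * outer y y * S⁻¹ := by
    rw [mul_outer, outer_mul, hRT]
  rw [dfpUpdate, dfpUpdate, hdot, hdot', h3]
  calc _ = (S⁻¹ * (1 - (dot y s)⁻¹ • outer y s)) * B * ((1 - (dot s y)⁻¹ • outer s y) * S⁻¹)
        + (dot y s)⁻¹ • (S⁻¹ * outer y y * S⁻¹) := by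
        simp only [mul_add, add_mul, mul_smul_comm, smul_mul_assoc, mul_assoc]
    _ = _ := by
        rw [← h1, ← h2]
        simp only [mul_assoc]

lemma norm_inv_mApp_grad_sub_le {d : ℕ} {g : E d → E d} {Hess : E d → Mat d} {xs : E d}
    {μ M : ℝ} (hμ : 0 < μ) (hM : 0 < M)
    (hHd : ∀ x, HasFDerivAt g (Matrix.toEuclideanCLM (𝕜 := ℝ) (Hess x)) x)
    (hHl : ∀ v, μ * ‖v‖ ^ 2 ≤ dot v (mApp (Hess xs) v))
    (hLip : ∀ x, spec (Hess x - Hess xs) ≤ M * ‖x - xs‖)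
    {S : Mat d} (hS : IsUnit S.det) (hST : Sᵀ = S) (hSS : S * S = Hess xs)
    {τ : ℝ} {a b : E d} (ha : sig M μ S xs a ≤ τ) (hb : sig M μ S xs b ≤ τ) :
    ‖mApp S⁻¹ (g a - g b) - mApp S (a - b)‖ ≤ τ * ‖mApp S (a - b)‖ := by
  have hlow := sqrt_mul_norm_le_norm_mApp hμ hST hSS hHl
  have hsq : 0 < Real.sqrt μ := Real.sqrt_pos.2 hμ
  have hss : Real.sqrt μ * Real.sqrt μ = μ := Real.mul_self_sqrt hμ.le
  have hpow : μ ^ ((3 : ℝ) / 2) = μ * Real.sqrt μ := by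
    rw [Real.sqrt_eq_rpow, show (3 : ℝ) / 2 = 1 + 1 / 2 by norm_num, Real.rpow_add hμ,
      Real.rpow_one]
  have hball : ∀ z, sig M μ S xs z ≤ τ → z ∈ Metric.closedBall xs (τ * μ / M) := by
    intro z hz
    rw [mem_closedBall_iff_norm, le_div_iff₀ hM]
    have h1 : M / (μ * Real.sqrt μ) * (Real.sqrt μ * ‖z - xs‖) ≤ τ := by
      refine le_trans ?_ hz
      rw [sig, hpow]
      gcongr
      exact hlow _
    have h2 : M / (μ * Real.sqrt μ) * (Real.sqrt μ * ‖z - xs‖) = M * ‖z - xs‖ / μ := by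
      field_simp
    rw [h2, div_le_iff₀ hμ] at h1
    linarith
  have hτ : 0 ≤ τ := le_trans (by unfold sig; positivity) ha
  have hmv : ‖g a - g b - mApp (Hess xs) (a - b)‖ ≤ τ * μ * ‖a - b‖ := by
    refine Convex.norm_image_sub_le_of_norm_hasFDerivWithin_le' (𝕜 := ℝ)
      (f' := fun z => Matrix.toEuclideanCLM (𝕜 := ℝ) (Hess z))
      (s := Metric.closedBall xs (τ * μ / M))
      (φ := Matrix.toEuclideanCLM (𝕜 := ℝ) (Hess xs))
      (fun z _ => (hHd z).hasFDerivWithinAt) (fun z hz => ?_) (convex_closedBall _ _)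
      (hball b hb) (hball a ha)
    rw [← map_sub]
    refine (hLip z).trans ?_
    rw [mem_closedBall_iff_norm, le_div_iff₀ hM] at hz
    linarith
  have heq : mApp S⁻¹ (g a - g b) - mApp S (a - b)
      = mApp S⁻¹ (g a - g b - mApp (Hess xs) (a - b)) := by
    rw [mApp_vec_sub S⁻¹ (g a - g b), ← hSS, mApp_mul, mApp_inv_mApp hS]
  have h1 := hlow (mApp S⁻¹ (g a - g b - mApp (Hess xs) (a - b)))
  rw [mApp_mApp_inv hS, ← heq] at h1
  have h2 := hlow (a - b)
  refine le_of_mul_le_mul_left ?_ hsq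
  calc _ ≤ _ := h1.trans hmv
    _ = Real.sqrt μ * (τ * (Real.sqrt μ * ‖a - b‖)) := by
        linear_combination -(τ * ‖a - b‖) * hss
    _ ≤ _ := by gcongr

lemma norm_mApp_newton_step_le {d : ℕ} {S B : Mat d} (hS : IsUnit S.det) {D τ r : ℝ}
    (hD : D < 1) (hB : spec (S⁻¹ * B * S⁻¹ - 1) ≤ D) (hr : τ + D ≤ r * (1 - D)) {e G : E d}
    (hG : ‖mApp S⁻¹ G - mApp S e‖ ≤ τ * ‖mApp S e‖) :
    ‖mApp S (e - mApp B⁻¹ G)‖ ≤ r * ‖mApp S e‖ := by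
  have hlow : ∀ v, (1 - D) * ‖v‖ ≤ ‖mApp (S⁻¹ * B * S⁻¹) v‖ := by
    intro v
    have h1 : v = mApp (S⁻¹ * B * S⁻¹) v - mApp (S⁻¹ * B * S⁻¹ - 1) v := by
      rw [mApp_mat_sub, mApp_one]; abel
    have h2 : ‖mApp (S⁻¹ * B * S⁻¹ - 1) v‖ ≤ D * ‖v‖ :=
      (norm_mApp_le _ _).trans (by gcongr)
    have h3 : ‖v‖ ≤ ‖mApp (S⁻¹ * B * S⁻¹) v‖ + ‖mApp (S⁻¹ * B * S⁻¹ - 1) v‖ := by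
      conv_lhs => rw [h1]
      exact norm_sub_le _ _
    linarith
  have hhat : IsUnit (S⁻¹ * B * S⁻¹) := by
    rw [← Matrix.mulVec_injective_iff_isUnit, ← Matrix.coe_mulVecLin,
      injective_iff_map_eq_zero]
    intro v hv
    have h1 : mApp (S⁻¹ * B * S⁻¹) (WithLp.toLp 2 v) = 0 := by
      simpa [mApp] using hv
    have h2 := hlow (WithLp.toLp 2 v)
    rw [h1, norm_zero] at h2
    have h3 : ‖(WithLp.toLp 2 v : E d)‖ = 0 :=
      le_antisymm (by nlinarith) (norm_nonneg _)
    simpa using h3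
  have hBdet : IsUnit B.det := by
    rw [Matrix.isUnit_iff_isUnit_det, Matrix.det_mul, Matrix.det_mul, IsUnit.mul_iff,
      IsUnit.mul_iff] at hhat
    exact hhat.1.2
  have heq : mApp (S⁻¹ * B * S⁻¹) (mApp S (e - mApp B⁻¹ G)) =
      mApp (S⁻¹ * B * S⁻¹ - 1) (mApp S e) - (mApp S⁻¹ G - mApp S e) := by
    rw [mApp_mat_sub, mApp_one, mApp_mul, mApp_mul, mApp_mul, mApp_mul, mApp_inv_mApp hS,
      mApp_inv_mApp hS, mApp_vec_sub B, mApp_mApp_inv hBdet, mApp_vec_sub]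
    abel
  have h1 := hlow (mApp S (e - mApp B⁻¹ G))
  rw [heq] at h1
  have h2 := (norm_mApp_le (S⁻¹ * B * S⁻¹ - 1) (mApp S e)).trans
    (mul_le_mul_of_nonneg_right hB (norm_nonneg _))
  have h3 := norm_sub_le (mApp (S⁻¹ * B * S⁻¹ - 1) (mApp S e)) (mApp S⁻¹ G - mApp S e)
  have h4 := mul_le_mul_of_nonneg_right hr (norm_nonneg (mApp S e))
  refine le_of_mul_le_mul_left ?_ (show 0 < 1 - D by linarith)
  linarith

theorem dfp_cumulative_residual_bound
    {d : ℕ}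
    (f : E d → ℝ) (g : E d → E d) (Hess : E d → Mat d) (xs : E d)
    (μ L M : ℝ) (hμ : 0 < μ) (hμL : μ ≤ L) (hM : 0 < M)
    -- `g` is the gradient of `f`, and `Hess` its Hessian (so `f` is twice differentiable)
    (hg : ∀ x, HasGradientAt f (g x) x)
    (hHd : ∀ x, HasFDerivAt g (Matrix.toEuclideanCLM (𝕜 := ℝ) (Hess x)) x)
    -- `xs` is the unique minimizer of `f`
    (hmin : ∀ x, f xs ≤ f x)
    (huniq : ∀ x, (∀ y, f x ≤ f y) → x = xs)
    -- Assumption 1: strong convexity and gradient Lipschitz continuity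
    (hgl : ∀ x y, μ * ‖x - y‖ ≤ ‖g x - g y‖)
    (hgu : ∀ x y, ‖g x - g y‖ ≤ L * ‖x - y‖)
    (hHl : ∀ x v, μ * ‖v‖ ^ 2 ≤ dot v (mApp (Hess x) v))
    (hHu : ∀ x v, dot v (mApp (Hess x) v) ≤ L * ‖v‖ ^ 2)
    -- Assumption 2: Hessian Lipschitz continuity toward the optimum
    (hLip : ∀ x, spec (Hess x - Hess xs) ≤ M * ‖x - xs‖)
    -- `sqH` is the positive definite square root `H_*^{1/2}` of `H_* = ∇²f(x_*)`
    (sqH : Mat d) (hsqH : sqH.PosDef) (hsqH2 : sqH * sqH = Hess xs)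
    -- the DFP method
    (x : ℕ → E d) (B : ℕ → Mat d)
    (hB0pd : (B 0).PosDef)
    (hxup : ∀ k, x (k+1) = x k - mApp (B k)⁻¹ (g (x k)))
    (hsne : ∀ k, x (k+1) - x k ≠ 0)
    (hBup : ∀ k, B (k+1) = dfpUpdate (B k) (x (k+1) - x k) (g (x (k+1)) - g (x k)))
    (ε δ r : ℝ) (hε : 0 < ε) (hδ : 0 < δ) (hr0 : 0 < r) (hr1 : r < 1)
    (hc1 : (4 * (2*δ + 1) / (1 - ε)^2 + (3 + ε) / (1 - ε)) * (ε / (1 - r)) ≤ δ)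
    (hc2 : ε + 2*δ ≤ r / (1 + r))
    (hσ0 : sig M μ sqH xs (x 0) ≤ ε)
    (hB0 : frob (sqH⁻¹ * B 0 * sqH⁻¹ - 1) ≤ δ) :
    ∀ k : ℕ, 1 ≤ k →
      ∑ t ∈ Finset.range k,
          ‖mApp (sqH⁻¹ * B t * sqH⁻¹ - 1) (mApp sqH (x (t+1) - x t))‖
            / ‖mApp sqH (x (t+1) - x t)‖ ≤
        2 * Real.sqrt 2 * δ * Real.sqrt (k:ℝ) := by
  have hS : IsUnit sqH.det := hsqH.det_pos.ne'.isUnit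
  have hST : sqHᵀ = sqH := by
    rw [← Matrix.conjTranspose_eq_transpose_of_trivial]; exact hsqH.isHermitian
  have hgxs : g xs = 0 := by
    have h1 := IsLocalMin.hasFDerivAt_eq_zero (Filter.Eventually.of_forall hmin)
      (hg xs).hasFDerivAt
    simpa using h1
  have hDr : ε + 2 * δ ≤ r * (1 - 2 * δ) ∧ ε + 2 * δ < 1 := by
    rw [le_div_iff₀ (by linarith)] at hc2
    constructor <;> nlinarith
  obtain ⟨hDr, hDr1⟩ := hDr
  have hε1 : ε < 1 := by linarith
  have hδ1 : 2 * δ < 1 := by linarith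
  set W := 4 * (2 * δ + 1) / (1 - ε) ^ 2 + (3 + ε) / (1 - ε) with hW
  have h1ε : 0 < 1 - ε := by linarith
  have hW0 : 0 ≤ W := by positivity
  set θ : ℕ → ℝ := fun t => ‖mApp (sqH⁻¹ * B t * sqH⁻¹ - 1) (mApp sqH (x (t+1) - x t))‖
            / ‖mApp sqH (x (t+1) - x t)‖ with hθ
  have hgeom : ∀ k : ℕ, W * ∑ t ∈ Finset.range k, ε * r ^ t ≤ δ := by
    intro k
    refine le_trans ?_ hc1
    rw [← Finset.mul_sum, div_eq_mul_inv ε]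
    gcongr
    have h1 : (∑ t ∈ Finset.range k, r ^ t) * (1 - r) = 1 - r ^ k := geom_sum_mul_neg r k
    rw [← one_div, le_div_iff₀ (by linarith), h1]
    linarith [pow_pos hr0 k]
  have main : ∀ k : ℕ, sig M μ sqH xs (x k) ≤ ε * r ^ k ∧
      frob (sqH⁻¹ * B k * sqH⁻¹ - 1) + ∑ t ∈ Finset.range k, θ t ^ 2 / (2 * (2 * δ))
        ≤ δ + W * ∑ t ∈ Finset.range k, ε * r ^ t := by
    intro k
    induction k with
    | zero => simpa using ⟨hσ0, hB0⟩
    | succ k ih =>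
      obtain ⟨ihσ, ihB⟩ := ih
      have hτ0 : 0 ≤ ε * r ^ k := by positivity
      have hτε : ε * r ^ k ≤ ε := mul_le_of_le_one_right hε.le (pow_le_one₀ hr0.le hr1.le)
      have hBk : frob (sqH⁻¹ * B k * sqH⁻¹ - 1) ≤ 2 * δ := by
        have h1 := hgeom k
        have h2 : 0 ≤ ∑ t ∈ Finset.range k, θ t ^ 2 / (2 * (2 * δ)) := by positivity
        linarith
      have hxs : sig M μ sqH xs xs ≤ ε * r ^ k := by simpa [sig, mApp] using hτ0
      have hgrad := norm_inv_mApp_grad_sub_le hμ hM hHd (hHl xs) hLip hS hST hsqH2 ihσ hxs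
      rw [hgxs, sub_zero] at hgrad
      have hstep := norm_mApp_newton_step_le hS hδ1 ((spec_le_frob _).trans hBk)
        (le_trans (by linarith) hDr) hgrad
      have hxe : x k - xs - mApp (B k)⁻¹ (g (x k)) = x (k + 1) - xs := by
        rw [hxup k]; abel
      rw [hxe] at hstep
      have hσ' : sig M μ sqH xs (x (k + 1)) ≤ r * sig M μ sqH xs (x k) := by
        unfold sig
        calc _ ≤ M / μ ^ ((3:ℝ)/2) * (r * ‖mApp sqH (x k - xs)‖) := by gcongr
          _ = _ := by ring
      have hσk : sig M μ sqH xs (x (k + 1)) ≤ ε * r ^ (k + 1) := by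
        calc _ ≤ r * (ε * r ^ k) := hσ'.trans (by gcongr)
          _ = _ := by ring
      have hσk' : sig M μ sqH xs (x (k + 1)) ≤ ε * r ^ k :=
        hσk.trans (by gcongr ε * ?_; exact pow_le_pow_of_le_one hr0.le hr1.le k.le_succ)
      refine ⟨hσk, ?_⟩
      have hy := norm_inv_mApp_grad_sub_le hμ hM hHd (hHl xs) hLip hS hST hsqH2 hσk' ihσ
      have hsk : mApp sqH (x (k + 1) - x k) ≠ 0 := by
        intro h0
        apply hsne k
        rw [← mApp_inv_mApp hS (x (k + 1) - x k), h0]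
        simp [mApp]
      have hup := frob_dfpUpdate_sub_one_le (sqH⁻¹ * B k * sqH⁻¹) hsk hτ0
        (hτε.trans_lt hε1) (by positivity) hBk hy
      rw [← inv_mul_dfpUpdate_mul_inv hS hST, ← hBup k] at hup
      have hWk : (4 * (2 * δ + 1) / (1 - ε * r ^ k) ^ 2
          + (3 + ε * r ^ k) / (1 - ε * r ^ k)) * (ε * r ^ k) ≤ W * (ε * r ^ k) := by
        rw [hW]
        gcongr
      rw [Finset.sum_range_succ, Finset.sum_range_succ, mul_add]
      change _ ≤ _ - θ k ^ 2 / (2 * (2 * δ)) + _ at hup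
      linarith
  intro k _
  have hsum : ∑ t ∈ Finset.range k, θ t ^ 2 ≤ 8 * δ ^ 2 := by
    have h1 := (main k).2
    have h2 := hgeom k
    have h3 := frob_nonneg (sqH⁻¹ * B k * sqH⁻¹ - 1)
    rw [← Finset.sum_div] at h1
    have h4 : (∑ t ∈ Finset.range k, θ t ^ 2) / (2 * (2 * δ)) ≤ 2 * δ := by linarith
    rw [div_le_iff₀ (by positivity)] at h4
    linarith
  have hcs : (∑ t ∈ Finset.range k, θ t) ^ 2 ≤ k * ∑ t ∈ Finset.range k, θ t ^ 2 := by
    simpa using sq_sum_le_card_mul_sum_sq (s := Finset.range k) (f := θ)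
  refine le_of_sq_le_sq ?_ (by positivity)
  calc _ ≤ (k : ℝ) * (8 * δ ^ 2) := hcs.trans (by gcongr)
    _ = _ := by
      rw [mul_pow, mul_pow, mul_pow, Real.sq_sqrt (by norm_num), Real.sq_sqrt (by positivity)]
      ring
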